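/- Define the finite-horizon value iterates v_0 = r̄ and v_{n+1} = r̄ + γ • (P *ᵥ v_n). Then for every Q : ι → ℝ satisfying the Bellman equation Q = r̄ + γ • (P *ᵥ Q), the sequence v_n converges pointwise to Q as n → ∞, i.e., for every i : ι, the sequence n ↦ v_n i tends to Q i. -/

import Mathlib

open Matrix

/-- A row-stochastic matrix does not increase a uniform bound on the entries of a vector. -/
theorem abs_mulVec_le_of_row_stochastic {ι : Type*} [Fintype ι]
    (P : Matrix ι ι ℝ) (hP0 : ∀ i j, 0 ≤ P i j) (hP1 : ∀ i, ∑ j, P i j = 1)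
    (x : ι → ℝ) {c : ℝ} (hx : ∀ j, |x j| ≤ c) (i : ι) : |(P *ᵥ x) i| ≤ c :=
  calc |(P *ᵥ x) i| ≤ ∑ j, |P i j * x j| := Finset.abs_sum_le_sum_abs _ _
    _ ≤ ∑ j, P i j * c := Finset.sum_le_sum fun j _ => by
        rw [abs_mul, abs_of_nonneg (hP0 i j)]
        exact mul_le_mul_of_nonneg_left (hx j) (hP0 i j)
    _ = c := by rw [← Finset.sum_mul, hP1, one_mul]

/-- Value iteration converges: with `v 0 = rbar` and `v (n+1) = rbar + γ • (P *ᵥ v n)`,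
for every solution `Q` of the Bellman equation `Q = rbar + γ • (P *ᵥ Q)`, the iterates
converge pointwise to `Q`: for every `i`, `v n i → Q i` as `n → ∞`. -/
theorem value_iteration_converges
    {ι : Type*} [Fintype ι] [Nonempty ι]
    (P : Matrix ι ι ℝ) (hP0 : ∀ i j, 0 ≤ P i j) (hP1 : ∀ i, ∑ j, P i j = 1)
    (rbar : ι → ℝ) (γ : ℝ) (hγ0 : 0 ≤ γ) (hγ1 : γ < 1)
    (v : ℕ → ι → ℝ) (hv0 : v 0 = rbar)
    (hvsucc : ∀ n, v (n + 1) = rbar + γ • (P *ᵥ v n)) :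
    ∀ Q : ι → ℝ, Q = rbar + γ • (P *ᵥ Q) →
      ∀ i : ι, Filter.Tendsto (fun n => v n i) Filter.atTop (nhds (Q i)) := by
  intro Q hQ i
  have bound : ∀ n i, |v n i - Q i| ≤ γ ^ n * ∑ j, |v 0 j - Q j| := by
    intro n
    induction n with
    | zero =>
      intro i
      simpa using Finset.single_le_sum (f := fun j => |v 0 j - Q j|)
        (fun j _ => abs_nonneg _) (Finset.mem_univ i)
    | succ n ih =>
      intro i
      have step : v (n + 1) i - Q i = γ * (P *ᵥ (v n - Q)) i := by
        have hQi := congrFun hQ i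
        rw [hvsucc, mulVec_sub]
        simp only [Pi.add_apply, Pi.smul_apply, Pi.sub_apply, smul_eq_mul] at hQi ⊢
        linarith
      rw [step, abs_mul, abs_of_nonneg hγ0, pow_succ', mul_assoc]
      exact mul_le_mul_of_nonneg_left
        (abs_mulVec_le_of_row_stochastic P hP0 hP1 (v n - Q) ih i) hγ0
  refine tendsto_iff_dist_tendsto_zero.2 (squeeze_zero (fun _ => dist_nonneg)
    (fun n => (Real.dist_eq _ _).trans_le (bound n i)) ?_)
  simpa using (tendsto_pow_atTop_nhds_zero_of_lt_one hγ0 hγ1).mul_const (∑ j, |v 0 j - Q j|)
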